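/- Let p be a prime with p ≡ 5 (mod 8). Then the quaternion algebra (−2, −p / ℚ) is ramified exactly at p and at ∞; concretely: the base change of (−2, −p / ℚ) to ℝ is a division ring, the base change of (−2, −p / ℚ) to the p-adic field ℚ_p is a division ring, and for every prime ℓ ≠ p the base change of (−2, −p / ℚ) to ℚ_ℓ is isomorphic as a ℚ_ℓ-algebra to the ring of 2×2 matrices over ℚ_ℓ. -/

import Mathlib

open Quaternion

lemma aux_unit {K : Type*} [Field K] (a b : K) (x : ℍ[K, a, b])
    (h : x.re ^ 2 - a * x.imI ^ 2 - b * x.imJ ^ 2 + a * b * x.imK ^ 2 ≠ 0) : IsUnit x := by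
  set N := x.re ^ 2 - a * x.imI ^ 2 - b * x.imJ ^ 2 + a * b * x.imK ^ 2 with hN
  refine ⟨⟨x, N⁻¹ • star x, ?_, ?_⟩, rfl⟩
  · rw [mul_smul_comm, show x * star x = N • 1 by ext <;> simp <;> ring, smul_smul,
      inv_mul_cancel₀ h, one_smul]
  · rw [smul_mul_assoc, show star x * x = N • 1 by ext <;> simp <;> ring, smul_smul,
      inv_mul_cancel₀ h, one_smul]

def auxBasis {K : Type*} [Field K] (a b u v : K) (h : u ^ 2 - a * v ^ 2 = b) :
    QuaternionAlgebra.Basis (Matrix (Fin 2) (Fin 2) K) a 0 b where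
  i := !![0, a; 1, 0]
  j := !![u, -a * v; v, -u]
  k := !![a * v, -a * u; u, -a * v]
  i_mul_i := by ext i j; fin_cases i <;> fin_cases j <;> simp
  j_mul_j := by
    subst h
    ext i j; fin_cases i <;> fin_cases j <;> simp <;> ring
  i_mul_j := by ext i j; fin_cases i <;> fin_cases j <;> simp
  j_mul_i := by ext i j; fin_cases i <;> fin_cases j <;> simp <;> ring

lemma aux_split {K : Type*} [Field K] (a b u v : K) (h : u ^ 2 - a * v ^ 2 = b)
    (h2 : (2 : K) ≠ 0) (ha : a ≠ 0) (hb : b ≠ 0) :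
    Nonempty (ℍ[K, a, b] ≃ₐ[K] Matrix (Fin 2) (Fin 2) K) := by
  have inj : Function.Injective (auxBasis a b u v h).liftHom := by
    rw [injective_iff_map_eq_zero]
    intro x hx
    have e00 := congrFun (congrFun hx 0) 0
    have e01 := congrFun (congrFun hx 0) 1
    have e10 := congrFun (congrFun hx 1) 0
    have e11 := congrFun (congrFun hx 1) 1
    simp [QuaternionAlgebra.Basis.lift, auxBasis, Algebra.algebraMap_eq_smul_one] at e00 e01 e10 e11
    have r0 : x.re = 0 := by
      apply mul_left_cancel₀ h2; linear_combination e00 + e11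
    have i0 : x.imI = 0 := by
      apply mul_left_cancel₀ h2
      apply mul_left_cancel₀ ha
      linear_combination e01 + a * e10
    have A : u * x.imJ + a * v * x.imK = 0 := by linear_combination e00 - r0
    have B : v * x.imJ + u * x.imK = 0 := by linear_combination e10 - i0
    have j0 : x.imJ = 0 := by
      apply mul_left_cancel₀ hb
      linear_combination u * A - a * v * B - x.imJ * h
    have k0 : x.imK = 0 := by
      apply mul_left_cancel₀ hb
      linear_combination u * B - v * A - x.imK * h
    ext <;> simpa
  have hf : Module.finrank K ℍ[K, a, b] = Module.finrank K (Matrix (Fin 2) (Fin 2) K) := by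
    rw [QuaternionAlgebra.finrank_eq_four, Module.finrank_matrix]; simp
  have surj : Function.Surjective (auxBasis a b u v h).liftHom :=
    (LinearMap.injective_iff_surjective_of_finrank_eq_finrank
      (f := (auxBasis a b u v h).liftHom.toLinearMap) hf).1 inj
  exact ⟨AlgEquiv.ofBijective _ ⟨inj, surj⟩⟩

lemma aux_hensel {l : ℕ} [Fact l.Prime] (a c : ℤ_[l]) (h : ‖a ^ 2 - c‖ < ‖2 * a‖ ^ 2) :
    ∃ z : ℤ_[l], z ^ 2 = c := by
  obtain ⟨z, hz, -⟩ := hensels_lemma (p := l) (R := ℤ_[l])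
    (F := (Polynomial.X ^ 2 - Polynomial.C c : Polynomial ℤ_[l])) (a := a)
    (by simpa [Polynomial.derivative_X_pow, one_add_one_eq_two] using h)
  exact ⟨z, by simpa [sub_eq_zero] using hz⟩

lemma aux_zmod {l : ℕ} [Fact l.Prime] (x : ℤ_[l]) : ‖x‖ < 1 ↔ PadicInt.toZMod x = 0 := by
  rw [← RingHom.mem_ker, PadicInt.ker_toZMod, IsLocalRing.mem_maximalIdeal, PadicInt.mem_nonunits]

lemma aux_norm1 {l : ℕ} [Fact l.Prime] (x : ℤ_[l]) (h : PadicInt.toZMod x ≠ 0) : ‖x‖ = 1 := by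
  by_contra h1
  exact h ((aux_zmod x).1 (lt_of_le_of_ne x.norm_le_one h1))

lemma aux_sq {l : ℕ} [Fact l.Prime] (hl : l ≠ 2) (a c : ℤ_[l])
    (h : PadicInt.toZMod (a ^ 2 - c) = 0) (ha : PadicInt.toZMod a ≠ 0) :
    ∃ z : ℤ_[l], z ^ 2 = c := by
  apply aux_hensel a c
  have h2 : (PadicInt.toZMod (2 * a)) ≠ 0 := by
    rw [map_mul, map_ofNat]
    exact mul_ne_zero (Ring.two_ne_zero (by rwa [ZMod.ringChar_zmod_n])) ha
  rw [aux_norm1 _ h2, one_pow]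
  exact (aux_zmod _).2 h

lemma aux_odd {l : ℕ} [Fact l.Prime] (hl : l ≠ 2) (p : ℕ) [hp : Fact p.Prime] (hlp : l ≠ p) :
    ∃ u v : ℤ_[l], u ^ 2 + 2 * v ^ 2 = -p := by
  have h2 : (2 : ZMod l) ≠ 0 := Ring.two_ne_zero (by rwa [ZMod.ringChar_zmod_n])
  have hp0 : (p : ZMod l) ≠ 0 := by
    rw [Ne, ZMod.natCast_eq_zero_iff, Nat.prime_dvd_prime_iff_eq Fact.out hp.out]
    exact hlp
  obtain ⟨x, y, hxy⟩ : ∃ x y : ZMod l, x ^ 2 + 2 * y ^ 2 = -p := by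
    obtain ⟨x, y, h⟩ := FiniteField.exists_root_sum_quadratic (R := ZMod l)
      (f := Polynomial.X ^ 2) (g := Polynomial.C 2 * Polynomial.X ^ 2 + Polynomial.C (p : ZMod l))
      (by simp) (by compute_degree!) (by
        rw [ZMod.card]; exact (Nat.Prime.eq_two_or_odd Fact.out).resolve_left hl)
    refine ⟨x, y, ?_⟩
    simp at h
    linear_combination h
  obtain ⟨X, rfl⟩ := ZMod.ringHom_surjective (PadicInt.toZMod (p := l)) x
  obtain ⟨Y, rfl⟩ := ZMod.ringHom_surjective (PadicInt.toZMod (p := l)) y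
  by_cases hX : PadicInt.toZMod X = 0
  · have hY : PadicInt.toZMod Y ≠ 0 := by
      intro hY
      rw [hX, hY] at hxy
      apply hp0
      linear_combination hxy
    have h2' : IsUnit (2 : ℤ_[l]) := by
      rw [PadicInt.isUnit_iff]; apply aux_norm1; rwa [map_ofNat]
    obtain ⟨w, hw⟩ := h2'.exists_right_inv
    obtain ⟨z, hz⟩ := aux_sq hl Y (w * (-p - X ^ 2)) (by
      have hw' := congrArg (PadicInt.toZMod (p := l)) hw
      simp only [map_mul, map_ofNat, map_one, map_sub, map_pow, map_neg, map_natCast] at hw' ⊢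
      linear_combination (PadicInt.toZMod w) * hxy - (PadicInt.toZMod Y)^2 * hw') hY
    exact ⟨X, z, by rw [hz]; linear_combination (-p - X ^ 2) * hw⟩
  · obtain ⟨z, hz⟩ := aux_sq hl X (-p - 2 * Y ^ 2) (by
      simp only [map_mul, map_ofNat, map_sub, map_pow, map_neg, map_natCast]
      linear_combination hxy) hX
    exact ⟨z, Y, by rw [hz]; ring⟩

lemma aux_two (p : ℕ) (hp8 : p % 8 = 5) :
    ∃ u v : ℤ_[2], u ^ 2 + 2 * v ^ 2 = -p := by
  obtain ⟨z, hz⟩ := aux_hensel (l := 2) 1 (-p - 2) (by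
    have h1 : ‖((p + 3 : ℤ) : ℤ_[2])‖ ≤ (2 : ℕ) ^ (-(3 : ℕ) : ℤ) := by
      rw [PadicInt.norm_int_le_pow_iff_dvd]
      norm_num; omega
    have h2 : ‖(2 : ℤ_[2])‖ = 2⁻¹ := by simpa using PadicInt.norm_p (p := 2)
    have h3 : (1 : ℤ_[2]) ^ 2 - (-p - 2) = ((p + 3 : ℤ) : ℤ_[2]) := by push_cast; ring
    rw [h3, mul_one, h2]
    refine lt_of_le_of_lt h1 ?_
    norm_num)
  exact ⟨z, 1, by rw [hz]; ring⟩

lemma aux_aniso {p : ℕ} [hp : Fact p.Prime] (hp8 : p % 8 = 5) (a b : ℚ_[p]) :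
    ∃ c : ℚ_[p], ‖a ^ 2 + 2 * b ^ 2‖ = ‖c‖ ^ 2 ∧ (c = 0 → a = 0 ∧ b = 0) := by
  have hp2 : p ≠ 2 := by rintro rfl; norm_num at hp8
  by_cases hab : ‖a‖ ≤ ‖b‖
  · refine ⟨b, ?_, ?_⟩
    · by_cases hb : b = 0
      · subst hb; have : a = 0 := by simpa using hab
        simp [this]
      have ht : ‖a / b‖ ≤ 1 := by
        rw [norm_div]; exact div_le_one_of_le₀ hab (norm_nonneg _)
      let t : ℤ_[p] := ⟨a / b, ht⟩
      have h1 : ‖t ^ 2 + 2‖ = 1 := by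
        apply aux_norm1
        rw [map_add, map_pow, map_ofNat]
        intro h
        have : IsSquare (-2 : ZMod p) := ⟨PadicInt.toZMod t, by linear_combination -h⟩
        rw [ZMod.exists_sq_eq_neg_two_iff hp2] at this
        omega
      have h2 : ‖(a / b) ^ 2 + 2‖ = 1 := by
        rw [PadicInt.norm_def] at h1
        exact h1
      rw [show a ^ 2 + 2 * b ^ 2 = ((a / b) ^ 2 + 2) * b ^ 2 by field_simp, norm_mul, h2, one_mul,
        norm_pow]
    · rintro rfl
      exact ⟨by simpa using hab, rfl⟩
  · push Not at hab
    refine ⟨a, ?_, ?_⟩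
    · have h2 : ‖(2 : ℚ_[p])‖ ≤ 1 := by simpa using Padic.norm_int_le_one (p := p) 2
      have h3 : ‖2 * b ^ 2‖ < ‖a ^ 2‖ := by
        rw [norm_mul, norm_pow, norm_pow]
        nlinarith [norm_nonneg b, sq_nonneg ‖b‖]
      rw [Padic.add_eq_max_of_ne h3.ne', max_eq_left h3.le, norm_pow]
    · rintro rfl
      simp at hab
      exact absurd hab (not_lt.2 (norm_nonneg _))

theorem quaternionAlgebra_neg_two_neg_p_ramified_exactly_at_p_and_infty
    (p : ℕ) [hp : Fact p.Prime] (hp8 : p % 8 = 5) :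
    (∀ x : ℍ[ℝ, -2, -(p : ℝ)], x ≠ 0 → IsUnit x) ∧
    (∀ x : ℍ[ℚ_[p], -2, -(p : ℚ_[p])], x ≠ 0 → IsUnit x) ∧
    (∀ (ℓ : ℕ) [Fact ℓ.Prime], ℓ ≠ p →
      Nonempty (ℍ[ℚ_[ℓ], -2, -(p : ℚ_[ℓ])] ≃ₐ[ℚ_[ℓ]] Matrix (Fin 2) (Fin 2) ℚ_[ℓ])) := by
  refine ⟨?_, ?_, ?_⟩
  · intro x hx
    apply aux_unit
    intro h
    apply hx
    have hp0 : (0 : ℝ) < p := by exact_mod_cast hp.out.pos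
    have h1 := sq_nonneg x.re
    have h2 := sq_nonneg x.imI
    have h3 := mul_nonneg hp0.le (sq_nonneg x.imJ)
    have h4 := mul_nonneg hp0.le (sq_nonneg x.imK)
    have e1 : x.re ^ 2 = 0 := by linarith
    have e2 : x.imI ^ 2 = 0 := by linarith
    have e3 : p * x.imJ ^ 2 = 0 := by linarith
    have e4 : p * x.imK ^ 2 = 0 := by linarith
    ext
    · simpa using e1
    · simpa using e2
    · simpa [hp0.ne'] using e3
    · simpa [hp0.ne'] using e4
  · intro x hx
    apply aux_unit
    intro h
    apply hx
    obtain ⟨c, hc, hc0⟩ := aux_aniso hp8 x.re x.imI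
    obtain ⟨d, hd, hd0⟩ := aux_aniso hp8 x.imJ x.imK
    have e : x.re ^ 2 + 2 * x.imI ^ 2 = -(p * (x.imJ ^ 2 + 2 * x.imK ^ 2)) := by
      linear_combination h
    have e2 : ‖c‖ ^ 2 = (p : ℝ)⁻¹ * ‖d‖ ^ 2 := by
      rw [← hc, e, norm_neg, norm_mul, hd, Padic.norm_p]
    have hpR : (p : ℝ) ≠ 0 := by exact_mod_cast hp.out.ne_zero
    have key : d = 0 := by
      by_contra hd1
      have hc1 : c ≠ 0 := by
        rintro rfl
        simp [hpR, hd1] at e2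
      rw [Padic.norm_eq_zpow_neg_valuation hc1, Padic.norm_eq_zpow_neg_valuation hd1,
        ← zpow_natCast, ← zpow_natCast, ← zpow_mul, ← zpow_mul, ← zpow_neg_one,
        ← zpow_add₀ hpR] at e2
      have := zpow_right_injective₀ (by exact_mod_cast hp.out.pos)
        (by exact_mod_cast hp.out.ne_one) e2
      push_cast at this
      omega
    have key2 : c = 0 := by simpa [key] using e2
    obtain ⟨a1, a2⟩ := hc0 key2
    obtain ⟨a3, a4⟩ := hd0 key
    ext <;> simpa
  · intro l hl hlp
    obtain ⟨u, v, huv⟩ : ∃ u v : ℤ_[l], u ^ 2 + 2 * v ^ 2 = -p := by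
      by_cases h2 : l = 2
      · subst h2; exact aux_two p hp8
      · exact aux_odd h2 p hlp
    have huv' : (u : ℚ_[l]) ^ 2 + 2 * (v : ℚ_[l]) ^ 2 = -p := by exact_mod_cast congrArg (fun z : ℤ_[l] => (z : ℚ_[l])) huv
    refine aux_split _ _ (u : ℚ_[l]) v ?_ two_ne_zero (neg_ne_zero.2 two_ne_zero) ?_
    · linear_combination huv'
    · exact neg_ne_zero.2 (by exact_mod_cast hp.out.ne_zero)
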